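/- arXiv:2010.13212 — 2 statements merged into one kernel-verified Lean document; each statement's English description precedes it below -/
import Mathlib

section
/- Let S be a real 2n×2n matrix that is positive definite, symmetric and symplectic, written in n×n blocks S = [[A,B],[C,D]], and suppose its characteristic polynomial factors as ∏_{j=1}^{n} (X − e^{μ_j})(X − e^{−μ_j}) with μ_j ≥ 0. Then the complex n×n matrix (1/2)((A+D) + i(C−B)) has determinant ∏_{j=1}^{n} cosh(μ_j). -/
open Matrix Polynomial

open scoped ComplexOrder in
theorem aux_nonneg {n : ℕ} (S : Matrix (Fin n ⊕ Fin n) (Fin n ⊕ Fin n) ℝ)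
    (A B C D : Matrix (Fin n) (Fin n) ℝ)
    (hblocks : S = Matrix.fromBlocks A B C D) (hpos : S.PosSemidef) :
    0 ≤ ((A + D).map Complex.ofReal + Complex.I • (C - B).map Complex.ofReal).det := by
  have h1 : (S.map Complex.ofReal).PosSemidef := by
    obtain ⟨R, hR⟩ : ∃ R : Matrix (Fin n ⊕ Fin n) (Fin n ⊕ Fin n) ℝ, S = Rᴴ * R := by
      open scoped MatrixOrder in
      exact CStarAlgebra.nonneg_iff_eq_star_mul_self.mp hpos.nonneg
    have : S.map Complex.ofReal = (R.map Complex.ofReal)ᴴ * R.map Complex.ofReal := by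
      rw [hR]
      ext i j
      simp [Matrix.mul_apply]
    rw [this]
    exact posSemidef_conjTranspose_mul_self _
  have h2 := (h1.conjTranspose_mul_mul_same
    (Matrix.fromRows (1 : Matrix (Fin n) (Fin n) ℂ) (-Complex.I • 1))).det_nonneg
  refine le_of_le_of_eq h2 (congrArg Matrix.det ?_)
  rw [hblocks, Matrix.fromBlocks_map, Matrix.conjTranspose_fromRows_eq_fromCols_conjTranspose,
    Matrix.fromCols_mul_fromBlocks, Matrix.fromCols_mul_fromRows]
  ext i j
  simp [mul_add, ← mul_assoc]
  ring

theorem aux_det {n : ℕ} (P Y : Matrix (Fin n) (Fin n) ℂ) :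
    (Matrix.fromBlocks P (-Y) Y P).det
      = (P + Complex.I • Y).det * (P - Complex.I • Y).det := by
  have h : Matrix.fromBlocks 1 (Complex.I • 1) 0 1 * Matrix.fromBlocks P (-Y) Y P *
      Matrix.fromBlocks 1 (-Complex.I • 1) 0 1
      = Matrix.fromBlocks (P + Complex.I • Y) 0 Y (P - Complex.I • Y) := by
    simp only [Matrix.fromBlocks_multiply]
    congr 1
    · simp
    · ext i j
      simp [← mul_assoc]
      ring
    · simp
    · ext i j
      simp; ring
  have h2 := congrArg Matrix.det h
  rw [Matrix.det_mul, Matrix.det_mul] at h2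
  simpa using h2

/-- Let `S` be a real `2n×2n` matrix that is positive definite, symmetric and
symplectic, written in `n×n` blocks `S = [[A,B],[C,D]]`, and suppose its characteristic polynomial
factors as `∏ (X − e^{μ_j})(X − e^{−μ_j})` with `μ_j ≥ 0`. Then the complex `n×n` matrix
`(1/2)((A+D) + i(C−B))` has determinant `∏ cosh(μ_j)`. -/
theorem statement0 (n : ℕ) (hn : 1 ≤ n)
    (S : Matrix (Fin n ⊕ Fin n) (Fin n ⊕ Fin n) ℝ)
    (A B C D : Matrix (Fin n) (Fin n) ℝ)
    (hblocks : S = Matrix.fromBlocks A B C D)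
    (hsym : S.IsSymm) (hpos : S.PosDef)
    (hsymp : Sᵀ * Matrix.fromBlocks 0 (-1) 1 0 * S =
      (Matrix.fromBlocks 0 (-1) 1 0 : Matrix (Fin n ⊕ Fin n) (Fin n ⊕ Fin n) ℝ))
    (μ : Fin n → ℝ) (hμ : ∀ j, 0 ≤ μ j)
    (hchar : S.charpoly =
      ∏ j : Fin n, ((X - Polynomial.C (Real.exp (μ j))) *
        (X - Polynomial.C (Real.exp (-μ j))))) :
    ((1 / 2 : ℂ) • ((A + D).map Complex.ofReal +
        Complex.I • (C - B).map Complex.ofReal)).det =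
      ∏ j : Fin n, (Real.cosh (μ j) : ℂ) := by
  have hnn := aux_nonneg S A B C D hblocks hpos.posSemidef
  set Q := (A + D).map Complex.ofReal + Complex.I • (C - B).map Complex.ofReal with hQ
  have hs : Aᵀ = A ∧ Cᵀ = B ∧ Bᵀ = C ∧ Dᵀ = D := by
    have := hsym.eq
    rw [hblocks, Matrix.fromBlocks_transpose, Matrix.fromBlocks_inj] at this
    exact this
  obtain ⟨hA, hC, hB, hD⟩ := hs
  -- the inverse of S
  set T := Matrix.fromBlocks D (-C) (-B) A with hT
  have hTS : T * S = 1 := by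
    have h0 := congrArg (fun M => Matrix.fromBlocks 0 1 (-1) 0 * M) hsymp
    simp only [hsym.eq] at h0
    rw [hblocks] at h0
    simp only [Matrix.fromBlocks_multiply] at h0
    rw [hT, hblocks, ← Matrix.fromBlocks_one, Matrix.fromBlocks_multiply]
    simpa [add_comm] using h0
  have hST : S * T = 1 := mul_eq_one_comm.mp hTS
  have hdetS : S.det = 1 := by
    have := Matrix.eval_charpoly S 0
    rw [hchar, Polynomial.eval_prod] at this
    simpa [Matrix.det_neg, ← Real.exp_add, ← two_mul] using this.symm
  have hdetT : T.det = 1 := by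
    have := congrArg Matrix.det hTS
    simpa [hdetS] using this
  have hmap : ∀ M : Matrix (Fin n ⊕ Fin n) (Fin n ⊕ Fin n) ℝ,
      M.map (⇑Complex.ofRealHom) = M.map Complex.ofReal := fun M => rfl
  have hev : ∀ z : ℂ, (Matrix.scalar _ z - S.map Complex.ofReal).det =
      ∏ j : Fin n, ((z - Real.exp (μ j)) * (z - Real.exp (-μ j))) := by
    intro z
    have h1 := Matrix.eval_charpoly (S.map Complex.ofRealHom) z
    rw [Matrix.charpoly_map, hchar] at h1
    rw [Polynomial.map_prod, Polynomial.eval_prod] at h1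
    simpa [hmap] using h1.symm
  have hfac : (Matrix.scalar _ Complex.I - S.map Complex.ofReal) *
      (Matrix.scalar _ (-Complex.I) - S.map Complex.ofReal) = 
      (S.map Complex.ofReal) * (S + T).map Complex.ofReal := by
    have e : (S.map Complex.ofReal) * (S + T).map Complex.ofReal
        = (S.map Complex.ofReal) * (S.map Complex.ofReal) + 1 := by
      have h := congrArg (fun M => M.map Complex.ofRealHom)
        (show S * (S + T) = S * S + 1 by rw [mul_add, hST])
      simp only [Matrix.map_mul] at h
      simp only [hmap] at h
      rw [h, ← hmap, ← hmap, Matrix.map_add _ (map_add _), Matrix.map_mul]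
      simp
    rw [e]
    have c := (Matrix.scalar_commute Complex.I (fun r => Commute.all _ _) (S.map Complex.ofReal)).eq
    have i2 : Matrix.scalar (Fin n ⊕ Fin n) Complex.I * Matrix.scalar _ Complex.I = -1 := by
      rw [← map_mul, Complex.I_mul_I, map_neg, map_one]
    rw [map_neg, sub_mul, mul_sub, mul_sub, mul_neg, mul_neg, i2, c]
    abel
  have hdet := congrArg Matrix.det hfac
  rw [Matrix.det_mul, Matrix.det_mul, hev, hev] at hdet
  have hd1 : (S.map Complex.ofReal).det = 1 := by
    have := (Complex.ofRealHom.map_det S)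
    rw [hdetS] at this
    simpa [hmap] using this.symm
  have hblk : (S + T).map Complex.ofReal = Matrix.fromBlocks ((A + D).map Complex.ofReal)
      (-(C - B).map Complex.ofReal) ((C - B).map Complex.ofReal) ((A + D).map Complex.ofReal) := by
    rw [hblocks, hT, Matrix.fromBlocks_add, Matrix.fromBlocks_map]
    congr 1 <;> ext i j <;> simp <;> ring
  have hQT : (A + D).map Complex.ofReal - Complex.I • (C - B).map Complex.ofReal = Qᵀ := by
    rw [hQ, ← hB]
    ext i j
    have a1 := congrFun (congrFun hA i) j
    have a2 := congrFun (congrFun hD i) j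
    simp only [Matrix.transpose_apply] at a1 a2
    simp [a1, a2]
    ring
  rw [hd1, one_mul, hblk, aux_det, hQT, ← hQ, Matrix.det_transpose] at hdet
  have hcosh : (∏ j : Fin n, ((Complex.I - Real.exp (μ j)) * (Complex.I - Real.exp (-μ j)))) *
      ∏ j : Fin n, ((-Complex.I - Real.exp (μ j)) * (-Complex.I - Real.exp (-μ j)))
      = (2 ^ n * ∏ j : Fin n, (Real.cosh (μ j) : ℂ)) ^ 2 := by
    have h2 : (2 : ℂ) ^ n = ∏ j : Fin n, (2 : ℂ) := by simp
    rw [h2, ← Finset.prod_mul_distrib, ← Finset.prod_mul_distrib, ← Finset.prod_pow]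
    refine Finset.prod_congr rfl fun j _ => ?_
    have he : (Real.exp (μ j) : ℂ) * Real.exp (-μ j) = 1 := by
      rw [← Complex.ofReal_mul, ← Real.exp_add]; simp
    rw [Real.cosh_eq]
    rw [Complex.ofReal_div, Complex.ofReal_add]
    generalize (Real.exp (μ j) : ℂ) = x at *
    generalize (Real.exp (-μ j) : ℂ) = y at *
    have hI := Complex.I_mul_I
    push_cast
    generalize Complex.I = i at *
    grind
  rw [hcosh] at hdet
  obtain ⟨q, hq0, hq⟩ : ∃ q : ℝ, 0 ≤ q ∧ Q.det = q := by
    rw [Complex.le_def] at hnn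
    exact ⟨Q.det.re, by simpa using hnn.1, Complex.ext (by simp) (by simpa using hnn.2.symm)⟩
  have hfin : q = 2 ^ n * ∏ j : Fin n, Real.cosh (μ j) := by
    rw [hq, ← sq] at hdet
    have h3 : (2 ^ n * ∏ j : Fin n, Real.cosh (μ j)) ^ 2 = q ^ 2 := by exact_mod_cast hdet
    refine ((sq_eq_sq₀ ?_ hq0).mp h3).symm
    exact mul_nonneg (by positivity) (Finset.prod_nonneg fun j _ => (Real.cosh_pos _).le)
  rw [Matrix.det_smul, hq, hfin]
  push_cast
  rw [Fintype.card_fin, ← mul_assoc, ← mul_pow]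
  simp
end

section
/- (Laplace asymptotics on the sphere) Let m ≥ 2 and let σ be the surface measure on the unit sphere S^{m−1} ⊂ ℝ^m. Then t^{(m−1)/2} e^{−t} ∫_{S^{m−1}} e^{t ξ₁} dσ(ξ) → (2π)^{(m−1)/2} as t → ∞, where ξ₁ = ⟨ξ, e₁⟩ is the first coordinate of ξ. -/
open Filter Topology MeasureTheory Metric

namespace LapSph

/-- squared Euclidean length of the transversal coordinates -/
noncomputable def q {n : ℕ} (y : Fin n → ℝ) : ℝ := ∑ i, (y i) ^ 2

/-- Euclidean norm in split coordinates -/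
noncomputable def N {n : ℕ} (p : ℝ × (Fin n → ℝ)) : ℝ := √(p.1 ^ 2 + q p.2)

/-- the integrand in split coordinates -/
noncomputable def h {n : ℕ} (t : ℝ) (p : ℝ × (Fin n → ℝ)) : ℝ :=
  Real.exp (-N p) * Real.exp (t * (p.1 / N p - 1))

/-- the region around the pole -/
def A (n : ℕ) : Set (ℝ × (Fin n → ℝ)) := {p | 0 < p.1 ∧ q p.2 < p.1 ^ 2}

/-- rescaled integrand -/
noncomputable def G {n : ℕ} (t : ℝ) (p : ℝ × (Fin n → ℝ)) : ℝ :=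
  {p : ℝ × (Fin n → ℝ) | 0 < p.1 ∧ q p.2 < t}.indicator
    (fun p => p.1 ^ n * Real.exp (-(p.1 * √(1 + q p.2 / t))) *
      Real.exp (t * (1 / √(1 + q p.2 / t) - 1))) p

lemma q_nonneg {n : ℕ} (y : Fin n → ℝ) : 0 ≤ q y := Finset.sum_nonneg fun _ _ => sq_nonneg _

lemma q_cont {n : ℕ} : Continuous (q : (Fin n → ℝ) → ℝ) := by unfold q; fun_prop

lemma N_cont {n : ℕ} : Continuous (N : ℝ × (Fin n → ℝ) → ℝ) := by
  have := q_cont (n := n)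
  unfold N; fun_prop

lemma q_smul {n : ℕ} (c : ℝ) (y : Fin n → ℝ) : q (c • y) = c ^ 2 * q y := by
  simp [q, mul_pow, Finset.mul_sum]

lemma h_meas {n : ℕ} (t : ℝ) : Measurable (h t : ℝ × (Fin n → ℝ) → ℝ) := by
  have := (N_cont (n := n)).measurable
  unfold h; fun_prop

lemma A_meas (n : ℕ) : MeasurableSet (A n) := by
  have := (q_cont (n := n)).measurable
  exact (measurableSet_lt measurable_const measurable_fst).inter
    (measurableSet_lt (f := fun p : ℝ × (Fin n → ℝ) => q p.2) (g := fun p => p.1 ^ 2)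
      (by fun_prop) (by fun_prop))

lemma G_meas {n : ℕ} (t : ℝ) : Measurable (G t : ℝ × (Fin n → ℝ) → ℝ) := by
  have := (q_cont (n := n)).measurable
  unfold G
  apply Measurable.indicator
  · fun_prop
  · exact (measurableSet_lt measurable_const measurable_fst).inter
      (measurableSet_lt (f := fun p : ℝ × (Fin n → ℝ) => q p.2) (g := fun _ => t)
        (by fun_prop) (by fun_prop))

lemma gauss_int {n : ℕ} {b : ℝ} (hb : 0 < b) :
    Integrable (fun y : Fin n → ℝ => Real.exp (-b * q y)) := by
  have := Integrable.fintype_prod (ι := Fin n) (μ := fun _ => (volume : Measure ℝ))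
    (f := fun _ x => Real.exp (-b * x ^ 2)) (fun _ => integrable_exp_neg_mul_sq hb)
  simpa [q, Finset.mul_sum, ← Real.exp_sum, volume_pi] using this

lemma gauss_val {n : ℕ} :
    ∫ y : Fin n → ℝ, Real.exp (-(1/2) * q y) = (2 * Real.pi) ^ ((n : ℝ) / 2) := by
  have := integral_fintype_prod_volume_eq_pow (ι := Fin n) (fun x : ℝ => Real.exp (-(1/2) * x ^ 2))
  simp only [← Real.exp_sum, ← Finset.mul_sum, integral_gaussian] at this
  simp only [q]
  rw [this, Fintype.card_fin, Real.sqrt_eq_rpow, ← Real.rpow_natCast, ← Real.rpow_mul (by positivity)]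
  congr 1 <;> ring

lemma rad_int (n : ℕ) : IntegrableOn (fun r : ℝ => r ^ n * Real.exp (-r)) (Set.Ioi 0) := by
  have := Real.GammaIntegral_convergent (s := n + 1) (by positivity)
  simpa [mul_comm] using this

lemma rad_pos (n : ℕ) : 0 < ∫ r in Set.Ioi (0:ℝ), r ^ n * Real.exp (-r) := by
  have := Real.Gamma_eq_integral (s := n + 1) (by positivity)
  have h2 := Real.Gamma_pos_of_pos (s := n + 1) (by positivity)
  rw [this] at h2
  simpa [mul_comm] using h2

/-- splitting off the first coordinate -/
noncomputable def sp (n : ℕ) (x : EuclideanSpace ℝ (Fin (n+1))) : ℝ × (Fin n → ℝ) :=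
  MeasurableEquiv.piFinSuccAbove (fun _ => ℝ) 0 (WithLp.ofLp x)

lemma sp_mp (n : ℕ) : MeasurePreserving (sp n) volume volume :=
  (volume_preserving_piFinSuccAbove (fun _ => ℝ) 0).comp (PiLp.volume_preserving_ofLp (Fin (n+1)))

lemma sp_me (n : ℕ) : MeasurableEmbedding (sp n) :=
  (MeasurableEquiv.measurableEmbedding _).comp
    (MeasurableEquiv.toLp 2 (Fin (n+1) → ℝ)).symm.measurableEmbedding

lemma sp_fst (n : ℕ) (x) : (sp n x).1 = x 0 := rfl

lemma N_sp (n : ℕ) (x) : N (sp n x) = ‖x‖ := by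
  rw [EuclideanSpace.norm_eq, Fin.sum_univ_succ]
  simp [N, q, sp_fst]
  rfl

lemma expN_int (n : ℕ) : Integrable (fun p : ℝ × (Fin n → ℝ) => Real.exp (-N p)) := by
  rw [← (sp_mp n).integrable_comp_emb (sp_me n)]
  simp only [Function.comp_def, N_sp]
  rw [integrable_fun_norm_addHaar volume (f := fun r => Real.exp (-r))]
  simpa using rad_int n

lemma polar (n : ℕ) (t : ℝ) :
    ∫ p : ℝ × (Fin n → ℝ), h t p =
      (∫ r in Set.Ioi (0:ℝ), r ^ n * Real.exp (-r)) *
       (Real.exp (-t) * ∫ ξ : sphere (0 : EuclideanSpace ℝ (Fin (n+1))) 1,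
          Real.exp (t * (ξ : EuclideanSpace ℝ (Fin (n+1))) 0)
        ∂((volume : Measure (EuclideanSpace ℝ (Fin (n+1)))).toSphere)) := by
  rw [← (sp_mp n).integral_comp (sp_me n)]
  simp only [h, N_sp, sp_fst]
  set μ := (volume : Measure (EuclideanSpace ℝ (Fin (n+1))))
  have hsing : MeasurableSet ({0} : Set (EuclideanSpace ℝ (Fin (n+1)))) :=
    isClosed_singleton.measurableSet
  calc
    _ = ∫ x : ({(0)}ᶜ : Set (EuclideanSpace ℝ (Fin (n+1)))),
          Real.exp (-‖x.1‖) * Real.exp (t * (x.1 0 / ‖x.1‖ - 1)) ∂(μ.comap (↑)) := by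
      rw [integral_subtype_comap hsing.compl
        fun x : EuclideanSpace ℝ (Fin (n+1)) =>
          Real.exp (-‖x‖) * Real.exp (t * (x 0 / ‖x‖ - 1)),
        restrict_compl_singleton]
    _ = ∫ x, Real.exp (t * (x.1.1 0 - 1)) * Real.exp (-x.2.1)
          ∂μ.toSphere.prod (.volumeIoiPow n) := by
      have := μ.measurePreserving_homeomorphUnitSphereProd.integral_comp
        (Homeomorph.measurableEmbedding _)
        (fun x => Real.exp (t * (x.1.1 0 - 1)) * Real.exp (-x.2.1))
      simp only [finrank_euclideanSpace, Fintype.card_fin, Nat.add_sub_cancel] at this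
      rw [← this]
      refine integral_congr_ae (.of_forall fun x => ?_)
      simp [div_eq_inv_mul, mul_comm]
    _ = (∫ ξ, Real.exp (t * (ξ.1 0 - 1)) ∂μ.toSphere) *
          ∫ x : Set.Ioi (0 : ℝ), Real.exp (-x.1) ∂.volumeIoiPow n :=
      integral_prod_mul (fun ξ : sphere (0 : EuclideanSpace ℝ (Fin (n+1))) 1 =>
          Real.exp (t * (ξ.1 0 - 1)))
        (fun x : Set.Ioi (0:ℝ) => Real.exp (-x.1))
    _ = _ := by
      rw [mul_comm]
      congr 1
      · simp only [Measure.volumeIoiPow, ENNReal.ofReal]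
        rw [integral_withDensity_eq_integral_smul,
          integral_subtype_comap measurableSet_Ioi
            fun a ↦ Real.toNNReal (a ^ n) • Real.exp (-a),
          setIntegral_congr_fun measurableSet_Ioi fun x hx ↦ ?_]
        · rw [NNReal.smul_def, Real.coe_toNNReal _ (pow_nonneg hx.out.le _)]; rfl
        · exact (measurable_subtype_coe.pow_const _).real_toNNReal
      · rw [← integral_const_mul]
        congr 1; ext ξ
        rw [← Real.exp_add]; congr 1; ring

lemma N_pos {n : ℕ} {p : ℝ × (Fin n → ℝ)} (hp : 0 < p.1) : 0 < N p :=
  Real.sqrt_pos.2 (by have := q_nonneg p.2; positivity)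

lemma le_N {n : ℕ} (p : ℝ × (Fin n → ℝ)) : p.1 ≤ N p :=
  Real.le_sqrt_of_sq_le (by linarith [q_nonneg p.2])

lemma h_nonneg {n : ℕ} (t : ℝ) (p : ℝ × (Fin n → ℝ)) : 0 ≤ h t p := by unfold h; positivity

lemma h_le {n : ℕ} {t : ℝ} (ht : 0 ≤ t) (p : ℝ × (Fin n → ℝ)) : h t p ≤ Real.exp (-N p) := by
  unfold h
  refine mul_le_of_le_one_right (Real.exp_pos _).le (Real.exp_le_one_iff.2 ?_)
  have : p.1 / N p ≤ 1 := div_le_one_of_le₀ (le_N p) (Real.sqrt_nonneg _)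
  exact mul_nonpos_of_nonneg_of_nonpos ht (by linarith)

lemma h_int {n : ℕ} {t : ℝ} (ht : 0 ≤ t) : Integrable (h t : ℝ × (Fin n → ℝ) → ℝ) :=
  (expN_int n).mono' (h_meas t).aestronglyMeasurable
    (.of_forall fun p => by rw [Real.norm_of_nonneg (h_nonneg t p)]; exact h_le ht p)

lemma h_le_compl {n : ℕ} {t : ℝ} (ht : 0 ≤ t) (p : ℝ × (Fin n → ℝ)) (hp : p ∉ A n) :
    h t p ≤ Real.exp (-(1/4) * t) * Real.exp (-N p) := by
  unfold h
  rw [mul_comm]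
  refine mul_le_mul_of_nonneg_right (Real.exp_le_exp.2 ?_) (Real.exp_pos _).le
  have : p.1 / N p ≤ 3/4 := by
    rcases le_or_gt p.1 0 with h0 | h0
    · exact (div_nonpos_of_nonpos_of_nonneg h0 (Real.sqrt_nonneg _)).trans (by norm_num)
    · have h1 : p.1 ^ 2 ≤ q p.2 := by
        by_contra hc
        exact hp ⟨h0, not_le.1 hc⟩
      rw [div_le_iff₀ (N_pos h0)]
      have : 4/3 * p.1 ≤ N p := Real.le_sqrt_of_sq_le (by nlinarith)
      linarith
  nlinarith

lemma tail (n : ℕ) (s : ℝ) : Tendsto (fun t : ℝ => t ^ s * ∫ p in (A n)ᶜ, h t p) atTop (𝓝 0) := by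
  have h1 := (tendsto_rpow_mul_exp_neg_mul_atTop_nhds_zero s (1/4) (by norm_num)).mul_const
    (∫ p : ℝ × (Fin n → ℝ), Real.exp (-N p))
  rw [zero_mul] at h1
  refine squeeze_zero' ?_ ?_ h1
  · filter_upwards [eventually_ge_atTop 0] with t ht
    exact mul_nonneg (Real.rpow_nonneg ht _) (integral_nonneg fun p => h_nonneg t p)
  · filter_upwards [eventually_ge_atTop 0] with t ht
    rw [mul_assoc, ← integral_const_mul (Real.exp (-(1/4) * t))]
    refine mul_le_mul_of_nonneg_left ?_ (Real.rpow_nonneg ht _)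
    refine (setIntegral_mono_on (h_int ht).integrableOn ((expN_int n).const_mul _).integrableOn
      (A_meas n).compl fun p hp => h_le_compl ht p hp).trans ?_
    exact setIntegral_le_integral ((expN_int n).const_mul _) (.of_forall fun p => by positivity)

lemma key_ineq {s : ℝ} (h0 : 0 ≤ s) (h1 : s ≤ 1) : 1 / √(1 + s) - 1 ≤ - (s / 4) := by
  have hp : 0 < √(1 + s) := Real.sqrt_pos.2 (by linarith)
  have h2 : 1 / √(1 + s) ≤ 1 - s / 4 := by
    rw [div_le_iff₀ hp]
    have h3 : 1 / (1 - s/4) ≤ √(1+s) := by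
      apply Real.le_sqrt_of_sq_le
      rw [div_pow, div_le_iff₀ (by nlinarith)]
      nlinarith [mul_nonneg h0 (sub_nonneg.2 h1), mul_nonneg h0 (mul_nonneg h0 h0)]
    rw [div_le_iff₀ (by linarith)] at h3
    linarith
  linarith

/-- dominating function -/
noncomputable def B {n : ℕ} (p : ℝ × (Fin n → ℝ)) : ℝ :=
  (Set.Ioi (0:ℝ)).indicator (fun r => r ^ n * Real.exp (-r)) p.1 * Real.exp (-(1/4) * q p.2)

lemma B_int (n : ℕ) : Integrable (B : ℝ × (Fin n → ℝ) → ℝ) :=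
  ((integrable_indicator_iff measurableSet_Ioi).2 (rad_int n)).mul_prod (gauss_int (by norm_num))

lemma G_le {n : ℕ} {t : ℝ} (ht : 0 < t) (p : ℝ × (Fin n → ℝ)) : ‖G t p‖ ≤ B p := by
  unfold G B
  have hq := q_nonneg p.2
  by_cases hp : p ∈ {p : ℝ × (Fin n → ℝ) | 0 < p.1 ∧ q p.2 < t}
  · rw [Set.indicator_of_mem hp, Set.indicator_of_mem (show p.1 ∈ Set.Ioi (0:ℝ) from hp.1)]
    have hx : 0 < p.1 := hp.1
    rw [Real.norm_of_nonneg (by positivity)]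
    have hs : 0 ≤ q p.2 / t := by positivity
    have hs1 : q p.2 / t ≤ 1 := (div_le_one ht).2 hp.2.le
    refine mul_le_mul (mul_le_mul_of_nonneg_left (Real.exp_le_exp.2 (neg_le_neg ?_))
      (by positivity)) (Real.exp_le_exp.2 ?_) (Real.exp_pos _).le (by positivity)
    · exact le_mul_of_one_le_right hx.le (Real.one_le_sqrt.2 (by linarith))
    · have := mul_le_mul_of_nonneg_left (key_ineq hs hs1) ht.le
      refine this.trans (le_of_eq ?_)
      field_simp
  · rw [Set.indicator_of_notMem hp, norm_zero]
    exact mul_nonneg (Set.indicator_nonneg (fun r hr => by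
      have : 0 < r := hr
      positivity) _) (Real.exp_pos _).le

lemma G_int {n : ℕ} {t : ℝ} (ht : 0 < t) : Integrable (G t : ℝ × (Fin n → ℝ) → ℝ) :=
  (B_int n).mono' (G_meas t).aestronglyMeasurable (.of_forall (G_le ht))

lemma lim_aux (a : ℝ) (ha : 0 ≤ a) :
    Tendsto (fun t : ℝ => t * (1 / √(1 + a / t) - 1)) atTop (𝓝 (-(1/2) * a)) := by
  have hs : Tendsto (fun t : ℝ => √(1 + a / t)) atTop (𝓝 1) := by
    have : Tendsto (fun t : ℝ => 1 + a / t) atTop (𝓝 (1 + 0)) :=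
      tendsto_const_nhds.add (tendsto_const_nhds.div_atTop tendsto_id)
    have := (Real.continuous_sqrt.tendsto _).comp this
    simpa [Function.comp_def] using this
  have h2 : Tendsto (fun t : ℝ => -a / (√(1 + a / t) * (1 + √(1 + a / t)))) atTop
      (𝓝 (-a / (1 * (1 + 1)))) :=
    tendsto_const_nhds.div (hs.mul (tendsto_const_nhds.add hs)) (by norm_num)
  have e : -a / (1 * (1 + 1)) = -(1/2) * a := by ring
  rw [e] at h2
  refine h2.congr' ?_
  filter_upwards [eventually_gt_atTop 0] with t ht
  have hb : 0 < 1 + a / t := by positivity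
  have hw : √(1 + a / t) ^ 2 = 1 + a / t := Real.sq_sqrt hb.le
  have hwp : 0 < √(1 + a / t) := Real.sqrt_pos.2 hb
  set w := √(1 + a / t)
  have ha' : a = t * (w ^ 2 - 1) := by rw [hw]; field_simp; ring
  rw [ha']
  field_simp
  ring

lemma G_lim (n : ℕ) : Tendsto (fun t : ℝ => ∫ p : ℝ × (Fin n → ℝ), G t p) atTop
    (𝓝 ((∫ r in Set.Ioi (0:ℝ), r ^ n * Real.exp (-r)) * (2 * Real.pi) ^ ((n : ℝ) / 2))) := by
  rw [← gauss_val, ← integral_indicator measurableSet_Ioi, ← integral_prod_mul]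
  refine tendsto_integral_filter_of_dominated_convergence B
    (.of_forall fun t => (G_meas t).aestronglyMeasurable)
    (by filter_upwards [eventually_gt_atTop 0] with t ht using .of_forall (G_le ht))
    (B_int n) (.of_forall fun p => ?_)
  by_cases hx : 0 < p.1
  · rw [Set.indicator_of_mem (show p.1 ∈ Set.Ioi (0:ℝ) from hx)]
    have hs : Tendsto (fun t : ℝ => √(1 + q p.2 / t)) atTop (𝓝 1) := by
      have : Tendsto (fun t : ℝ => 1 + q p.2 / t) atTop (𝓝 (1 + 0)) :=
        tendsto_const_nhds.add (tendsto_const_nhds.div_atTop tendsto_id)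
      have := (Real.continuous_sqrt.tendsto _).comp this
      simpa [Function.comp_def] using this
    have h1 : Tendsto (fun t : ℝ => Real.exp (-(p.1 * √(1 + q p.2 / t)))) atTop
        (𝓝 (Real.exp (-(p.1 * 1)))) :=
      (Real.continuous_exp.tendsto _).comp (hs.const_mul p.1).neg
    have h2 := (Real.continuous_exp.tendsto _).comp (lim_aux (q p.2) (q_nonneg _))
    rw [mul_one] at h1
    refine ((h1.const_mul (p.1 ^ n)).mul h2).congr' ?_
    filter_upwards [eventually_gt_atTop (q p.2)] with t ht
    unfold G
    rw [Set.indicator_of_mem (show p ∈ {p : ℝ × (Fin n → ℝ) | 0 < p.1 ∧ q p.2 < t} from ⟨hx, ht⟩)]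
    rfl
  · rw [Set.indicator_of_notMem (show p.1 ∉ Set.Ioi (0:ℝ) from hx), zero_mul]
    refine tendsto_const_nhds.congr fun t => ?_
    unfold G
    rw [Set.indicator_of_notMem fun hc => hx hc.1]

lemma subst (n : ℕ) {t : ℝ} (ht : 0 < t) :
    t ^ ((n : ℝ) / 2) * ∫ p in A n, h t p = ∫ p : ℝ × (Fin n → ℝ), G t p := by
  rw [← integral_indicator (A_meas n)]
  have hi := (h_int (n := n) ht.le).indicator (A_meas n)
  rw [Measure.volume_eq_prod] at hi ⊢
  have hG := G_int (n := n) ht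
  rw [Measure.volume_eq_prod] at hG
  rw [integral_prod _ hi, integral_prod _ hG, ← integral_const_mul]
  congr 1
  ext x
  by_cases hx : 0 < x
  · have hst : 0 < √t := Real.sqrt_pos.2 ht
    have key := Measure.integral_comp_smul_of_nonneg (volume : Measure (Fin n → ℝ))
      (fun y => (A n).indicator (h t) (x, y)) (x / √t) (hR := by positivity)
    have e : t ^ ((n : ℝ) / 2) = √t ^ n := by
      rw [Real.sqrt_eq_rpow, ← Real.rpow_natCast, ← Real.rpow_mul ht.le]
      congr 1; ring
    have : t ^ ((n : ℝ) / 2) * ∫ y, (A n).indicator (h t) (x, y) =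
        x ^ n * ∫ z, (A n).indicator (h t) (x, (x / √t) • z) := by
      rw [key, e]
      simp only [Module.finrank_fin_fun, smul_eq_mul]
      rw [div_pow]
      field_simp
    rw [this, ← integral_const_mul]
    congr 1
    ext z
    have hq := q_nonneg z
    have hqs : q ((x / √t) • z) = x ^ 2 * (q z / t) := by
      rw [q_smul, div_pow, Real.sq_sqrt ht.le]; ring
    have hmem : (x, (x / √t) • z) ∈ A n ↔
        (x, z) ∈ {p : ℝ × (Fin n → ℝ) | 0 < p.1 ∧ q p.2 < t} := by
      simp only [A, Set.mem_ofPred_eq, hx, true_and, hqs]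
      rw [← div_lt_one ht]
      constructor
      · intro hh
        by_contra hc
        nlinarith [sq_pos_of_pos hx, not_lt.1 hc]
      · intro hh
        nlinarith [sq_pos_of_pos hx]
    unfold G
    by_cases hz : (x, z) ∈ {p : ℝ × (Fin n → ℝ) | 0 < p.1 ∧ q p.2 < t}
    · rw [Set.indicator_of_mem (hmem.2 hz), Set.indicator_of_mem hz]
      have hN : N (x, (x / √t) • z) = x * √(1 + q z / t) := by
        simp only [N, hqs]
        rw [show x ^ 2 + x ^ 2 * (q z / t) = x ^ 2 * (1 + q z / t) by ring,
          Real.sqrt_mul (by positivity), Real.sqrt_sq hx.le]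
      simp only [h, hN]
      rw [mul_assoc, div_mul_eq_div_div, div_self hx.ne']
    · rw [Set.indicator_of_notMem (fun hc => hz (hmem.1 hc)), Set.indicator_of_notMem hz, mul_zero]
  · have h1 : ∀ y, (A n).indicator (h t) (x, y) = 0 := fun y =>
      Set.indicator_of_notMem (fun hc => hx hc.1) _
    have h2 : ∀ y : Fin n → ℝ, G t (x, y) = 0 := fun y =>
      Set.indicator_of_notMem (fun hc => hx hc.1) _
    simp [h1, h2]

lemma main (n : ℕ) : Tendsto
      (fun t : ℝ => t ^ ((n : ℝ) / 2) * Real.exp (-t) *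
        ∫ ξ : sphere (0 : EuclideanSpace ℝ (Fin (n+1))) 1,
          Real.exp (t * (ξ : EuclideanSpace ℝ (Fin (n+1))) 0)
        ∂((volume : Measure (EuclideanSpace ℝ (Fin (n+1)))).toSphere))
      atTop (𝓝 ((2 * Real.pi) ^ ((n : ℝ) / 2))) := by
  have hC := rad_pos n
  have h1 := ((G_lim n).add (tail n ((n : ℝ) / 2))).const_mul
    (∫ r in Set.Ioi (0:ℝ), r ^ n * Real.exp (-r))⁻¹
  rw [add_zero, inv_mul_cancel_left₀ hC.ne'] at h1
  refine h1.congr' ?_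
  filter_upwards [eventually_gt_atTop 0] with t ht
  rw [← subst n ht, ← mul_add, integral_add_compl (A_meas n) (h_int ht.le), polar,
    inv_mul_eq_div, div_eq_iff hC.ne']
  ring

end LapSph

/-- **Laplace asymptotics on the sphere.** Let `m ≥ 2` and let `σ` be the surface
measure on the unit sphere `S^{m−1} ⊂ ℝ^m` (here `volume.toSphere`). Then
`t^{(m−1)/2} e^{−t} ∫_{S^{m−1}} e^{t ξ₁} dσ(ξ) → (2π)^{(m−1)/2}` as `t → ∞`, where `ξ₁` is the
first coordinate of `ξ`. -/
theorem statement18 (m : ℕ) (hm : 2 ≤ m) :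
    Tendsto
      (fun t : ℝ => t ^ (((m : ℝ) - 1) / 2) * Real.exp (-t) *
        ∫ ξ : sphere (0 : EuclideanSpace ℝ (Fin m)) 1,
          Real.exp (t * (ξ : EuclideanSpace ℝ (Fin m)) ⟨0, by omega⟩)
        ∂((volume : Measure (EuclideanSpace ℝ (Fin m))).toSphere))
      atTop (𝓝 ((2 * Real.pi) ^ (((m : ℝ) - 1) / 2))) := by
  obtain ⟨n, rfl⟩ : ∃ n, m = n + 1 := ⟨m - 1, by omega⟩
  have e : (((n + 1 : ℕ) : ℝ) - 1) / 2 = (n : ℝ) / 2 := by push_cast; ring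
  rw [e]
  exact LapSph.main n
end
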